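/- There exist constants C > 0 and k_0 such that the following holds for all k ≥ k_0. Let η be a real number with C·log k/(k−1) < η ≤ 1, let R be a connected rainbow graph on vertex set [k] with edge set E and minimum degree at least η(k−1), viewed as a T-edge-colored complete graph with T = E ∪ {∅}, and let H be an n-vertex T-edge-colored complete graph in which every vertex x satisfies d(x) ≥ n^{k−1}/(k^{k−1}−1). Then for every x ∈ V(H), the non-edge degree d_∅(x) is less than (1 − η/2)·n. -/

import Mathlib

open Finset Filter

open scoped Classical

section Defs

variable {T : Type}

/-- A coloring of the complete graph is symmetric. -/
def IsSym {V : Type} (χ : V → V → T) : Prop := ∀ u v, χ u v = χ v u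

/-- `copyCount k n R χ` : the number of `k`-element subsets of `Fin n` whose coloring
induced by `χ` is isomorphic (as an edge-colored complete graph) to `R`. -/
noncomputable def copyCount (k n : ℕ) (R : Fin k → Fin k → T) (χ : Fin n → Fin n → T) : ℕ :=
  ((Finset.powersetCard k (Finset.univ : Finset (Fin n))).filter
    (fun S => ∃ φ : Fin k → Fin n, Function.Injective φ ∧ (∀ a, φ a ∈ S) ∧
      ∀ a b : Fin k, a ≠ b → χ (φ a) (φ b) = R a b)).card

/-- `maxCopyCount k n R = I(R,n)` : the maximum of `copyCount` over all symmetric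
`T`-colorings of the complete graph on `n` vertices. -/
noncomputable def maxCopyCount [Fintype T] (k n : ℕ) (R : Fin k → Fin k → T) : ℕ :=
  Finset.sup ((Finset.univ : Finset (Fin n → Fin n → T)).filter (fun χ => IsSym χ))
    (fun χ => copyCount k n R χ)

/-- `vertDeg k n R χ x = d(x)` : the number of `k`-subsets containing `x` whose induced
coloring is isomorphic to `R`. -/
noncomputable def vertDeg (k n : ℕ) (R : Fin k → Fin k → T) (χ : Fin n → Fin n → T)
    (x : Fin n) : ℕ :=
  ((Finset.powersetCard k (Finset.univ : Finset (Fin n))).filter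
    (fun S => x ∈ S ∧ ∃ φ : Fin k → Fin n, Function.Injective φ ∧ (∀ a, φ a ∈ S) ∧
      ∀ a b : Fin k, a ≠ b → χ (φ a) (φ b) = R a b)).card

/-- `embCount k n R χ i x = d_i(x)` : the number of injective color-preserving maps
`φ : Fin k → Fin n` with `φ i = x`. -/
noncomputable def embCount (k n : ℕ) (R : Fin k → Fin k → T) (χ : Fin n → Fin n → T)
    (i : Fin k) (x : Fin n) : ℕ :=
  ((Finset.univ : Finset (Fin k → Fin n)).filter
    (fun φ => Function.Injective φ ∧ φ i = x ∧
      ∀ a b : Fin k, a ≠ b → χ (φ a) (φ b) = R a b)).card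

/-- `Nset k n R χ i x = N_i(x)` : the set of vertices `y ≠ x` lying in the image of some
injective color-preserving map `φ : Fin k → Fin n` with `φ i = x`. -/
noncomputable def Nset (k n : ℕ) (R : Fin k → Fin k → T) (χ : Fin n → Fin n → T)
    (i : Fin k) (x : Fin n) : Finset (Fin n) :=
  (Finset.univ : Finset (Fin n)).filter
    (fun y => y ≠ x ∧ ∃ φ : Fin k → Fin n, Function.Injective φ ∧ φ i = x ∧
      (∀ a b : Fin k, a ≠ b → χ (φ a) (φ b) = R a b) ∧ ∃ a, φ a = y)

/-- `colorDeg χ x c = d_c(x)` : the number of vertices `y ≠ x` with `χ x y = c`. -/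
noncomputable def colorDeg {n : ℕ} (χ : Fin n → Fin n → T) (x : Fin n) (c : T) : ℕ :=
  ((Finset.univ : Finset (Fin n)).filter (fun y => y ≠ x ∧ χ x y = c)).card

end Defs

/-- The rainbow `k`-clique: the edge `ij` gets color `{i,j}`. -/
def rainbowClique (k : ℕ) : Fin k → Fin k → Finset (Fin k) := fun i j => {i, j}

/-- A rainbow graph `G` on `[k]`, viewed as an edge-colored complete graph: edges `ij ∈ E`
get color `{i,j}`, non-edges get color `∅`. -/
noncomputable def rainbowOf {k : ℕ} (G : SimpleGraph (Fin k)) :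
    Fin k → Fin k → Finset (Fin k) :=
  fun i j => if G.Adj i j then {i, j} else ∅

/-- `B(x)` : the set of neighbors of `x`, i.e. vertices joined to `x` by a non-`∅` color. -/
noncomputable def Bset {k n : ℕ} (χ : Fin n → Fin n → Finset (Fin k)) (x : Fin n) :
    Finset (Fin n) :=
  (Finset.univ : Finset (Fin n)).filter (fun y => y ≠ x ∧ χ x y ≠ ∅)

/-- The degree of vertex `i` in the graph `G`. -/
noncomputable def degR {k : ℕ} (G : SimpleGraph (Fin k)) (i : Fin k) : ℕ :=
  ((Finset.univ : Finset (Fin k)).filter (fun j => G.Adj i j)).card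

/-- The color-preserving maps `φ : Fin k → Fin n` that agree with `ψ` on `S` and send every
vertex outside `S` into `M`. -/
noncomputable def extensions {k n : ℕ} (G : SimpleGraph (Fin k))
    (χ : Fin n → Fin n → Finset (Fin k)) (S : Finset (Fin k)) (ψ : Fin k → Fin n)
    (M : Finset (Fin n)) : Finset (Fin k → Fin n) :=
  Finset.univ.filter fun φ => (∀ s ∈ S, φ s = ψ s) ∧ (∀ j ∉ S, φ j ∈ M) ∧
    ∀ a b : Fin k, a ≠ b → χ (φ a) (φ b) = rainbowOf G a b

/-- The vertices outside `S` with a neighbor in `S`. -/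
noncomputable def outerBoundary {k : ℕ} (G : SimpleGraph (Fin k)) (S : Finset (Fin k)) :
    Finset (Fin k) :=
  Finset.univ.filter fun j => j ∉ S ∧ ∃ l ∈ S, G.Adj l j

/-- The vertices of `M` whose colors towards `ψ(S)` allow them to play the role `j`. -/
noncomputable def candidates {k n : ℕ} (G : SimpleGraph (Fin k))
    (χ : Fin n → Fin n → Finset (Fin k)) (S : Finset (Fin k)) (ψ : Fin k → Fin n)
    (M : Finset (Fin n)) (j : Fin k) : Finset (Fin n) :=
  M.filter fun y => ∀ l ∈ S, χ (ψ l) y = rainbowOf G l j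

/-- The vertices of `M` that are joined to `ψ(S)` by non-edges only. -/
noncomputable def isolated {k n : ℕ} (χ : Fin n → Fin n → Finset (Fin k))
    (S : Finset (Fin k)) (ψ : Fin k → Fin n) (M : Finset (Fin n)) : Finset (Fin n) :=
  M.filter fun y => ∀ l ∈ S, χ (ψ l) y = ∅

section Extensions

variable {k n : ℕ} {G : SimpleGraph (Fin k)} {χ : Fin n → Fin n → Finset (Fin k)}
  {S : Finset (Fin k)} {ψ : Fin k → Fin n} {M : Finset (Fin n)}

lemma eq_of_rainbowOf_eq {l j j' : Fin k} (h : G.Adj l j)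
    (he : rainbowOf G l j = rainbowOf G l j') : j = j' := by
  unfold rainbowOf at he
  rw [if_pos h] at he
  split_ifs at he with h'
  · have hj : j ∈ ({l, j'} : Finset (Fin k)) := by rw [← he]; simp
    simp only [Finset.mem_insert, Finset.mem_singleton] at hj
    exact hj.resolve_left h.ne'
  · simp at he

lemma sum_candidates_add_isolated_le :
    ∑ j ∈ outerBoundary G S, (candidates G χ S ψ M j).card + (isolated χ S ψ M).card
      ≤ M.card := by
  rw [← Finset.card_biUnion, ← Finset.card_union_of_disjoint]
  · refine Finset.card_le_card fun y hy => ?_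
    simp only [Finset.mem_union, Finset.mem_biUnion, candidates, isolated,
      Finset.mem_filter] at hy
    rcases hy with ⟨_, _, h⟩ | h <;> exact h.1
  · refine Finset.disjoint_left.2 fun y hy hy0 => ?_
    simp only [Finset.mem_biUnion, candidates, isolated, outerBoundary,
      Finset.mem_filter] at hy hy0
    obtain ⟨j, ⟨_, _, l, hl, hlj⟩, _, hy⟩ := hy
    have h := hy l hl
    rw [hy0.2 l hl, rainbowOf, if_pos hlj] at h
    exact absurd h.symm (by simp)
  · intro j hj j' _ hne
    refine Finset.disjoint_left.2 fun y hy hy' => hne ?_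
    simp only [candidates, outerBoundary, Finset.mem_coe, Finset.mem_filter] at hj hy hy'
    obtain ⟨_, _, l, hl, hlj⟩ := hj
    exact eq_of_rainbowOf_eq hlj ((hy.2 l hl).symm.trans (hy'.2 l hl))

lemma card_extensions_le_prod_mul {K : ℝ}
    (hK : ∀ ρ : Fin k → Fin n,
      ((extensions G χ (S ∪ outerBoundary G S) ρ (isolated χ S ψ M)).card : ℝ) ≤ K) :
    ((extensions G χ S ψ M).card : ℝ)
      ≤ (∏ j ∈ outerBoundary G S, ((candidates G χ S ψ M j).card : ℝ)) * K := by
  set T := outerBoundary G S with hT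
  have hTS : ∀ j ∈ T, j ∉ S := fun j hj => by
    simp only [hT, outerBoundary, Finset.mem_filter] at hj
    exact hj.2.1
  let f : (Fin k → Fin n) → (Fin k → Fin n) := fun φ j => if j ∈ T then φ j else ψ j
  let P : Finset (Fin k → Fin n) :=
    Fintype.piFinset fun j => if j ∈ T then candidates G χ S ψ M j else {ψ j}
  have hcol : ∀ φ ∈ extensions G χ S ψ M, ∀ j ∉ S, φ j ∈ candidates G χ S ψ M j := by
    intro φ hφ j hj
    simp only [extensions, Finset.mem_filter] at hφ
    obtain ⟨_, h1, h2, h3⟩ := hφ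
    refine Finset.mem_filter.2 ⟨h2 j hj, fun l hl => ?_⟩
    rw [← h1 l hl]
    exact h3 l j fun h => hj (h ▸ hl)
  have hmaps : ∀ φ ∈ extensions G χ S ψ M, f φ ∈ P := by
    intro φ hφ
    refine Fintype.mem_piFinset.2 fun j => ?_
    by_cases hj : j ∈ T
    · simpa [f, hj] using hcol φ hφ j (hTS j hj)
    · simp [f, hj]
  have hfib : ∀ ρ ∈ P, (((extensions G χ S ψ M).filter fun φ => f φ = ρ).card : ℝ) ≤ K := by
    intro ρ _
    refine le_trans ?_ (hK ρ)
    refine Nat.cast_le.2 (Finset.card_le_card fun φ hφ => ?_)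
    obtain ⟨hext, rfl⟩ := Finset.mem_filter.1 hφ
    have hc := hcol φ hext
    obtain ⟨_, h1, _, h3⟩ := Finset.mem_filter.1 hext
    refine Finset.mem_filter.2 ⟨Finset.mem_univ _, fun s hs => ?_, fun j hj => ?_, h3⟩
    · by_cases hsT : s ∈ T
      · simp [f, hsT]
      · simpa [f, hsT] using h1 s ((Finset.mem_union.1 hs).resolve_right hsT)
    · rw [Finset.mem_union, not_or] at hj
      obtain ⟨hM, hl⟩ := Finset.mem_filter.1 (hc j hj.1)
      refine Finset.mem_filter.2 ⟨hM, fun l hlS => ?_⟩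
      rw [hl l hlS, rainbowOf, if_neg]
      intro hadj
      exact hj.2 (Finset.mem_filter.2 ⟨Finset.mem_univ _, hj.1, l, hlS, hadj⟩)
  have hP : (P.card : ℝ) = ∏ j ∈ T, ((candidates G χ S ψ M j).card : ℝ) := by
    have h : P.card = ∏ j ∈ T, (candidates G χ S ψ M j).card := by
      rw [Fintype.card_piFinset, ← Finset.prod_subset (Finset.subset_univ T)]
      · exact Finset.prod_congr rfl fun j hj => by rw [if_pos hj]
      · intro j _ hj
        rw [if_neg hj, Finset.card_singleton]
    rw [h, Nat.cast_prod]
  rw [Finset.card_eq_sum_card_fiberwise hmaps, Nat.cast_sum, ← hP, ← nsmul_eq_mul]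
  exact Finset.sum_le_card_nsmul _ _ _ hfib

lemma prod_card_le_pow_mul_exp {ι α : Type*} (T : Finset ι) (A : ι → Finset α) {μ : ℝ}
    (hμ : 0 < μ) :
    ∏ j ∈ T, ((A j).card : ℝ)
      ≤ (μ * Real.exp (-1)) ^ T.card * Real.exp ((∑ j ∈ T, ((A j).card : ℝ)) / μ) := by
  rw [Finset.sum_div, Real.exp_sum, ← Finset.prod_const, ← Finset.prod_mul_distrib]
  refine Finset.prod_le_prod (fun j _ => Nat.cast_nonneg _) fun j _ => ?_
  have h := Real.add_one_le_exp (((A j).card : ℝ) / μ + -1)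
  rw [neg_add_cancel_right, div_le_iff₀ hμ, Real.exp_add] at h
  linarith

lemma outerBoundary_nonempty (hG : G.Connected) (hS : S.Nonempty) (hS' : S ≠ Finset.univ) :
    (outerBoundary G S).Nonempty := by
  obtain ⟨a, ha⟩ := hS
  obtain ⟨b, hb⟩ : ∃ b, b ∉ S := by
    by_contra! h
    exact hS' (Finset.eq_univ_iff_forall.2 h)
  obtain ⟨p⟩ := hG.preconnected a b
  obtain ⟨d, _, h1, h2⟩ := p.exists_boundary_dart (S : Set (Fin k)) ha hb
  exact ⟨d.snd, Finset.mem_filter.2 ⟨Finset.mem_univ _, h2, d.fst, h1, d.adj⟩⟩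

lemma card_union_outerBoundary_compl :
    (Sᶜ).card = (outerBoundary G S).card + ((S ∪ outerBoundary G S)ᶜ).card := by
  rw [← Finset.card_union_of_disjoint]
  · congr 1
    ext j
    simp only [outerBoundary, Finset.mem_union, Finset.mem_compl, Finset.mem_filter,
      Finset.mem_univ, true_and]
    by_cases hj : j ∈ S
    · simp [hj]
    · simpa [hj] using em (∃ l ∈ S, G.Adj l j)
  · refine Finset.disjoint_left.2 fun j hj hj' => ?_
    simp only [Finset.mem_compl, Finset.mem_union] at hj'
    exact hj' (Or.inr hj)

lemma card_extensions_le (hG : G.Connected) {μ : ℝ} (hμ : 0 < μ) (hS : S.Nonempty) :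
    ((extensions G χ S ψ M).card : ℝ)
      ≤ (μ * Real.exp (-1)) ^ (Sᶜ).card * Real.exp ((M.card : ℝ) / μ) := by
  induction hm : (Sᶜ).card using Nat.strong_induction_on generalizing S ψ M with
  | _ m ih =>
    by_cases hS' : S = Finset.univ
    · have h1 : (extensions G χ S ψ M).card ≤ 1 := by
        refine Finset.card_le_one.2 fun φ hφ φ' hφ' => funext fun j => ?_
        simp only [extensions, Finset.mem_filter] at hφ hφ'
        rw [hφ.2.1 j (hS' ▸ Finset.mem_univ j), hφ'.2.1 j (hS' ▸ Finset.mem_univ j)]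
      have hm0 : m = 0 := by rw [← hm, hS']; simp
      rw [hm0, pow_zero, one_mul]
      exact (Nat.cast_le_one.2 h1).trans (Real.one_le_exp (by positivity))
    · have hT := Finset.card_pos.2 (outerBoundary_nonempty hG hS hS')
      have hc := card_union_outerBoundary_compl (G := G) (S := S)
      have hle := sum_candidates_add_isolated_le (G := G) (χ := χ) (S := S) (ψ := ψ) (M := M)
      refine (card_extensions_le_prod_mul fun ρ =>
        ih _ (by omega) (hS.mono Finset.subset_union_left) rfl).trans ?_
      refine (mul_le_mul_of_nonneg_right (prod_card_le_pow_mul_exp _ _ hμ)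
        (by positivity)).trans ?_
      rw [← hm, hc, pow_add, mul_mul_mul_comm, ← Real.exp_add, ← add_div]
      gcongr
      exact_mod_cast hle

lemma card_extensions_singleton_le (hG : G.Connected) {μ : ℝ} (hμ : 0 < μ) (i : Fin k)
    {s : ℝ} (hs : (M.card : ℝ) ≤ s + (isolated χ {i} ψ M).card) :
    ((extensions G χ {i} ψ M).card : ℝ)
      ≤ μ ^ (k - 1) * (1 / 2) ^ degR G i *
        Real.exp (((M.card : ℝ) + s) / μ - ((k - 1 : ℕ) : ℝ)) := by
  have hdeg : (outerBoundary G {i}).card = degR G i := by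
    unfold outerBoundary degR
    congr 1
    ext j
    simp only [Finset.mem_filter, Finset.mem_univ, true_and, Finset.mem_singleton,
      exists_eq_left, and_iff_right_iff_imp]
    exact fun h => h.ne'
  have hle : (∑ j ∈ outerBoundary G {i}, ((candidates G χ {i} ψ M j).card : ℝ))
      + (isolated χ {i} ψ M).card ≤ M.card := by
    exact_mod_cast sum_candidates_add_isolated_le (G := G) (χ := χ) (S := {i})
  have hc := card_union_outerBoundary_compl (G := G) (S := {i})
  rw [Finset.card_compl, Finset.card_singleton, Fintype.card_fin, hdeg] at hc
  refine (card_extensions_le_prod_mul fun ρ =>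
    card_extensions_le hG hμ (by simp)).trans ?_
  refine (mul_le_mul_of_nonneg_right (prod_card_le_pow_mul_exp _ _ (half_pos hμ))
    (by positivity)).trans ?_
  rw [hdeg, mul_mul_mul_comm, ← Real.exp_add, sub_eq_neg_add,
    Real.exp_add (-((k - 1 : ℕ) : ℝ))]
  have hpow : (μ / 2 * Real.exp (-1)) ^ degR G i *
      (μ * Real.exp (-1)) ^ (({i} ∪ outerBoundary G {i})ᶜ).card
      = μ ^ (k - 1) * (1 / 2) ^ degR G i * Real.exp (-((k - 1 : ℕ) : ℝ)) := by
    have he : Real.exp (-((k - 1 : ℕ) : ℝ)) = Real.exp (-1) ^ (k - 1) := by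
      rw [← Real.exp_nat_mul, mul_neg_one]
    rw [he, hc, pow_add, pow_add, mul_pow, mul_pow, div_eq_mul_one_div, mul_pow]
    ring
  rw [hpow, mul_assoc _ (Real.exp _) (Real.exp _)]
  gcongr
  rw [div_div_eq_mul_div, ← add_div]
  exact div_le_div_of_nonneg_right (by linarith) hμ.le

lemma vertDeg_le_sum_card_extensions (x : Fin n) :
    vertDeg k n (rainbowOf G) χ x
      ≤ ∑ i : Fin k, (extensions G χ {i} (fun _ => x) (Finset.univ.erase x)).card := by
  refine le_trans (Finset.card_le_card (t := Finset.univ.biUnion fun i : Fin k =>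
    (extensions G χ {i} (fun _ => x) (Finset.univ.erase x)).image
      fun φ => Finset.univ.image φ) ?_) (Finset.card_biUnion_le.trans
        (Finset.sum_le_sum fun i _ => Finset.card_image_le))
  intro A hA
  simp only [Finset.mem_filter, Finset.mem_powersetCard] at hA
  obtain ⟨⟨_, hcard⟩, hx, φ, hinj, hmem, hcol⟩ := hA
  have himg : Finset.univ.image φ = A := by
    refine Finset.eq_of_subset_of_card_le ?_ ?_
    · exact Finset.image_subset_iff.2 fun a _ => hmem a
    · rw [Finset.card_image_of_injective _ hinj, hcard, Finset.card_fin]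
  rw [← himg] at hx
  obtain ⟨i, _, hi⟩ := Finset.mem_image.1 hx
  refine Finset.mem_biUnion.2 ⟨i, Finset.mem_univ _, Finset.mem_image.2 ⟨φ, ?_, himg⟩⟩
  refine Finset.mem_filter.2 ⟨Finset.mem_univ _, ?_, fun j hj => ?_, hcol⟩
  · simpa using hi
  · rw [Finset.mem_singleton] at hj
    exact Finset.mem_erase.2 ⟨fun h => hj (hinj (h.trans hi.symm)), Finset.mem_univ _⟩

lemma isolated_singleton_card (i : Fin k) (x : Fin n) :
    (isolated χ {i} (fun _ => x) (Finset.univ.erase x)).card = colorDeg χ x ∅ := by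
  unfold isolated colorDeg
  congr 1
  ext y
  simp

end Extensions

lemma half_pow_mul_exp_le {k d : ℕ} (hk : 2 ≤ k) (hd : 20 * Real.log k ≤ d) :
    (1 / 2 : ℝ) ^ d * Real.exp ((d : ℝ) / 2) ≤ ((k : ℝ) ^ 3)⁻¹ := by
  have hk0 : (0 : ℝ) < k := by positivity
  have h2 := Real.log_two_gt_d9
  have h1 : (1 / 2 : ℝ) ^ d = Real.exp (-(d * Real.log 2)) := by
    rw [Real.exp_neg, Real.exp_nat_mul, Real.exp_log two_pos, one_div, inv_pow]
  have h3 : ((k : ℝ) ^ 3)⁻¹ = Real.exp (-(3 * Real.log k)) := by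
    rw [Real.exp_neg]
    congr 1
    rw [show (3 : ℝ) = ((3 : ℕ) : ℝ) by norm_num, Real.exp_nat_mul, Real.exp_log hk0]
  rw [h1, h3, ← Real.exp_add, Real.exp_le_exp]
  have hd0 : (0 : ℝ) ≤ d := Nat.cast_nonneg d
  nlinarith

lemma pow_div_sub_one_le {k n : ℕ} (hk : 2 ≤ k) :
    ((n : ℝ) / ((k : ℝ) - 1)) ^ (k - 1) ≤ 3 * ((n : ℝ) / k) ^ (k - 1) := by
  have hk1 : (1 : ℝ) ≤ (k : ℝ) - 1 := by
    have : (2 : ℝ) ≤ k := by exact_mod_cast hk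
    linarith
  have hk0 : (0 : ℝ) < k := by linarith
  have hcast : ((k - 1 : ℕ) : ℝ) = (k : ℝ) - 1 := by
    rw [Nat.cast_sub (by omega), Nat.cast_one]
  have hsplit : (n : ℝ) / ((k : ℝ) - 1) = (1 / ((k : ℝ) - 1) + 1) * ((n : ℝ) / k) := by
    field_simp
    ring
  rw [hsplit, mul_pow]
  gcongr
  calc (1 / ((k : ℝ) - 1) + 1) ^ (k - 1)
      ≤ Real.exp (1 / ((k : ℝ) - 1)) ^ (k - 1) := by
        gcongr
        exact Real.add_one_le_exp _
    _ = Real.exp 1 := by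
        rw [← Real.exp_nat_mul, hcast, mul_one_div_cancel (by linarith)]
    _ ≤ 3 := by linarith [Real.exp_one_lt_d9]

/-- for suitable absolute constants `C > 0` and `k₀`, in any `H` whose vertices all
satisfy `d(x) ≥ n^{k−1}/(k^{k−1}−1)` (with respect to a connected rainbow graph `R` on `[k]`,
`k ≥ k₀`, of minimum degree at least `η(k−1)` where `C log k/(k−1) < η ≤ 1`), every non-edge
degree is less than `(1 − η/2)·n`. -/
theorem max_nonedge_degree_sparse :
    ∃ C : ℝ, 0 < C ∧ ∃ k₀ : ℕ, ∀ k : ℕ, k₀ ≤ k → ∀ η : ℝ,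
      C * Real.log k / ((k : ℝ) - 1) < η → η ≤ 1 →
      ∀ G : SimpleGraph (Fin k), G.Connected →
      (∀ i : Fin k, η * ((k : ℝ) - 1) ≤ (degR G i : ℝ)) →
      ∀ n : ℕ, ∀ χ : Fin n → Fin n → Finset (Fin k), IsSym χ →
      (∀ x : Fin n,
        (n : ℝ) ^ (k - 1) / ((k : ℝ) ^ (k - 1) - 1) ≤ (vertDeg k n (rainbowOf G) χ x : ℝ)) →
      ∀ x : Fin n,
        (colorDeg χ x (∅ : Finset (Fin k)) : ℝ) < (1 - η / 2) * (n : ℝ) := by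
  refine ⟨20, by norm_num, 2, fun k hk η hη _ G hG hmin n χ _ hdeg x => ?_⟩
  by_contra! hcon
  have hk2 : (2 : ℝ) ≤ k := by exact_mod_cast hk
  have hk1 : (0 : ℝ) < (k : ℝ) - 1 := by linarith
  have hn : (0 : ℝ) < n := by exact_mod_cast x.pos
  have hcast : ((k - 1 : ℕ) : ℝ) = (k : ℝ) - 1 := by
    rw [Nat.cast_sub (by omega), Nat.cast_one]
  rw [div_lt_iff₀ hk1] at hη
  set μ : ℝ := (n : ℝ) / ((k : ℝ) - 1) with hμdef
  have hμ : 0 < μ := div_pos hn hk1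
  have hM : ((Finset.univ.erase x).card : ℝ) ≤ n := by
    exact_mod_cast (Finset.card_le_univ _).trans (Fintype.card_fin n).le
  have hone : ∀ i : Fin k,
      ((extensions G χ {i} (fun _ => x) (Finset.univ.erase x)).card : ℝ)
        ≤ μ ^ (k - 1) * ((k : ℝ) ^ 3)⁻¹ := by
    intro i
    refine (card_extensions_singleton_le hG hμ i (s := η / 2 * n) ?_).trans ?_
    · rw [isolated_singleton_card]
      linarith
    · rw [mul_assoc]
      refine mul_le_mul_of_nonneg_left ?_ (by positivity)
      refine le_trans ?_ (half_pow_mul_exp_le hk (hη.le.trans (hmin i)))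
      gcongr
      have h1 : (((Finset.univ.erase x).card : ℝ) + η / 2 * n) / μ
          ≤ ((n : ℝ) + η / 2 * n) / μ := by gcongr
      have h2 : ((n : ℝ) + η / 2 * n) / μ = ((k : ℝ) - 1) + η * ((k : ℝ) - 1) / 2 := by
        rw [hμdef]
        field_simp
      have h3 := hmin i
      rw [hcast]
      linarith
  have hsum : (vertDeg k n (rainbowOf G) χ x : ℝ) ≤ k * (μ ^ (k - 1) * ((k : ℝ) ^ 3)⁻¹) := by
    refine (Nat.cast_le.2 (vertDeg_le_sum_card_extensions x)).trans ?_
    rw [Nat.cast_sum]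
    refine (Finset.sum_le_card_nsmul _ _ _ fun i _ => hone i).trans ?_
    rw [Finset.card_fin, nsmul_eq_mul]
  have hq : 0 < ((n : ℝ) / k) ^ (k - 1) := by positivity
  have hupper : (vertDeg k n (rainbowOf G) χ x : ℝ) < ((n : ℝ) / k) ^ (k - 1) := by
    refine hsum.trans_lt ?_
    have h1 : (k : ℝ) * (μ ^ (k - 1) * ((k : ℝ) ^ 3)⁻¹) = μ ^ (k - 1) / (k : ℝ) ^ 2 := by
      field_simp
    rw [h1, div_lt_iff₀ (by positivity)]
    have h2 := pow_div_sub_one_le (n := n) hk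
    have h3 : (4 : ℝ) ≤ (k : ℝ) ^ 2 := by nlinarith
    have h4 := mul_le_mul_of_nonneg_left h3 hq.le
    linarith
  have hkpow : (1 : ℝ) < (k : ℝ) ^ (k - 1) := one_lt_pow₀ (by linarith) (by omega)
  have hlower : ((n : ℝ) / k) ^ (k - 1) ≤ (n : ℝ) ^ (k - 1) / ((k : ℝ) ^ (k - 1) - 1) := by
    rw [div_pow]
    exact div_le_div_of_nonneg_left (by positivity) (by linarith) (by linarith)
  linarith [hdeg x]
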